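/- arXiv:2308.12693 — 3 statements merged into one kernel-verified Lean document; each statement's English description precedes it below -/
import Mathlib

section
/- Suppose α ∈ Alt_I is ≺-maximal in Alt_I, i.e., there is no β ∈ Alt_I with α ≺ β. Then the only β ∈ Alt_I such that α is subordinate to β is β = α. -/
noncomputable section

/-- A permutation on `I`: an injective `2*k`-tuple with values in `I`
(for `|I| = 2*k` this is exactly a bijection from `{1,…,2k}` to `I`). -/
def PermOn (k : ℕ) (I : Finset ℕ) : Type :=
  {x : Fin (2 * k) → ℕ // Function.Injective x ∧ ∀ i, x i ∈ I}

/-- The set `S^x_i`, with `0`-based index `j` (so `j = i - 1`). -/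
def Sset (k : ℕ) (x : Fin (2 * k) → ℕ) (j : Fin (2 * k)) : Finset ℕ :=
  insert (x j)
    ((Finset.univ.filter (fun t : Fin (2 * k) => (t : ℕ) < 2 * ((j : ℕ) / 2))).image x)

/-- `x` is subordinate to `y`: `S^x_{2i-1} ∈ {S^y_{2i-1}, S^y_{2i}}` for all `1 ≤ i ≤ k`. -/
def Subordinate (k : ℕ) (x y : Fin (2 * k) → ℕ) : Prop :=
  ∀ i : ℕ, ∀ h : i < k,
    Sset k x ⟨2 * i, by omega⟩ = Sset k y ⟨2 * i, by omega⟩ ∨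
    Sset k x ⟨2 * i, by omega⟩ = Sset k y ⟨2 * i + 1, by omega⟩

/-- Alternating permutation. -/
def IsAlt (k : ℕ) (x : Fin (2 * k) → ℕ) : Prop :=
  (∀ i : ℕ, ∀ h : i < k, x ⟨2 * i, by omega⟩ < x ⟨2 * i + 1, by omega⟩) ∧
  (∀ i : ℕ, ∀ h : i + 1 < k, x ⟨2 * i + 2, by omega⟩ < x ⟨2 * i + 1, by omega⟩)

/-- Sum of the `m`-th block (0-based). -/
def blockSum (k : ℕ) (x : Fin (2 * k) → ℕ) (m : ℕ) (h : m < k) : ℕ :=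
  x ⟨2 * m, by omega⟩ + x ⟨2 * m + 1, by omega⟩

/-- The order `≺`: lexicographic on block sums read from the last block. -/
def PermLt (k : ℕ) (x y : Fin (2 * k) → ℕ) : Prop :=
  ∃ j : ℕ, ∃ hj : j < k,
    blockSum k x (k - 1 - j) (by omega) < blockSum k y (k - 1 - j) (by omega) ∧
    ∀ i : ℕ, i < j →
      blockSum k x (k - 1 - i) (by omega) = blockSum k y (k - 1 - i) (by omega)

/-- The subgroup `S^even_{2k}` generated by the transpositions `(2i-1, 2i)`, `1 ≤ i ≤ k`. -/
def Seven (k : ℕ) : Subgroup (Equiv.Perm (Fin (2 * k))) :=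
  Subgroup.closure
    { σ | ∃ (i : ℕ) (h : i < k),
        σ = Equiv.swap (⟨2 * i, by omega⟩ : Fin (2 * k)) ⟨2 * i + 1, by omega⟩ }

/-- The subgroup `S^odd_{2k}` generated by the transpositions `(2i, 2i+1)`, `1 ≤ i ≤ k-1`. -/
def Sodd (k : ℕ) : Subgroup (Equiv.Perm (Fin (2 * k))) :=
  Subgroup.closure
    { σ | ∃ (i : ℕ) (h : i + 1 < k),
        σ = Equiv.swap (⟨2 * i + 1, by omega⟩ : Fin (2 * k)) ⟨2 * i + 2, by omega⟩ }

/-- `set4 k x i p q r s` agrees with `x` except at the (0-based) positions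
`2i, 2i+1, 2i+2, 2i+3`, where it takes the values `p, q, r, s`. -/
def set4 (k : ℕ) (x : Fin (2 * k) → ℕ) (i : ℕ) (p q r s : ℕ) : Fin (2 * k) → ℕ :=
  fun j =>
    if (j : ℕ) = 2 * i then p
    else if (j : ℕ) = 2 * i + 1 then q
    else if (j : ℕ) = 2 * i + 2 then r
    else if (j : ℕ) = 2 * i + 3 then s
    else x j

/-- Generators of type (1): `x + x'` where `x'` interchanges the two values of a block of `x`. -/
def SwapSet (k : ℕ) (I : Finset ℕ) : Set (PermOn k I →₀ ℚ) :=
  { v | ∃ (x x' : PermOn k I) (i : ℕ) (h : i < k),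
      x'.1 = x.1 ∘ (Equiv.swap (⟨2 * i, by omega⟩ : Fin (2 * k)) ⟨2 * i + 1, by omega⟩) ∧
      v = Finsupp.single x 1 + Finsupp.single x' 1 }

/-- Generators of type (2): the Garnir elements
`x(ab/cd) − x(ac/bd) + x(ad/bc) + x(bc/ad) − x(bd/ac) + x(cd/ab)`. -/
def GarnirSet (k : ℕ) (I : Finset ℕ) : Set (PermOn k I →₀ ℚ) :=
  { v | ∃ (x y₁ y₂ y₃ y₄ y₅ : PermOn k I) (i : ℕ) (h : i + 1 < k),
      (y₁.1 = set4 k x.1 i (x.1 ⟨2 * i, by omega⟩) (x.1 ⟨2 * i + 2, by omega⟩)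
          (x.1 ⟨2 * i + 1, by omega⟩) (x.1 ⟨2 * i + 3, by omega⟩) ∧
       y₂.1 = set4 k x.1 i (x.1 ⟨2 * i, by omega⟩) (x.1 ⟨2 * i + 3, by omega⟩)
          (x.1 ⟨2 * i + 1, by omega⟩) (x.1 ⟨2 * i + 2, by omega⟩) ∧
       y₃.1 = set4 k x.1 i (x.1 ⟨2 * i + 1, by omega⟩) (x.1 ⟨2 * i + 2, by omega⟩)
          (x.1 ⟨2 * i, by omega⟩) (x.1 ⟨2 * i + 3, by omega⟩) ∧
       y₄.1 = set4 k x.1 i (x.1 ⟨2 * i + 1, by omega⟩) (x.1 ⟨2 * i + 3, by omega⟩)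
          (x.1 ⟨2 * i, by omega⟩) (x.1 ⟨2 * i + 2, by omega⟩) ∧
       y₅.1 = set4 k x.1 i (x.1 ⟨2 * i + 2, by omega⟩) (x.1 ⟨2 * i + 3, by omega⟩)
          (x.1 ⟨2 * i, by omega⟩) (x.1 ⟨2 * i + 1, by omega⟩)) ∧
      v = Finsupp.single x 1 - Finsupp.single y₁ 1 + Finsupp.single y₂ 1
          + Finsupp.single y₃ 1 - Finsupp.single y₄ 1 + Finsupp.single y₅ 1 }

/-- The subspace `M_I` of `ℚ⟨Perm_I⟩`. -/
def MI (k : ℕ) (I : Finset ℕ) : Submodule ℚ (PermOn k I →₀ ℚ) :=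
  Submodule.span ℚ (SwapSet k I ∪ GarnirSet k I)

/-- The simplex `φ_I(x) = {S^x_1, S^x_3, …, S^x_{2k-1}}`. -/
def phiMap (k : ℕ) (x : Fin (2 * k) → ℕ) : Finset (Finset ℕ) :=
  Finset.univ.image (fun i : Fin k => Sset k x ⟨2 * (i : ℕ), by have := i.isLt; omega⟩)

/-- The face `F(x, ε) = {S^x_{2i-1+ε_i} : 1 ≤ i ≤ k}`. -/
def Fface (k : ℕ) (x : Fin (2 * k) → ℕ) (ε : Fin k → Bool) : Finset (Finset ℕ) :=
  Finset.univ.image (fun i : Fin k =>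
    Sset k x ⟨2 * (i : ℕ) + (if ε i then 1 else 0), by have := i.isLt; split <;> omega⟩)

/-- The chain `c(x) = Σ_ε (−1)^{ε_1+⋯+ε_k} e_{F(x,ε)}`. -/
def chain (k : ℕ) (x : Fin (2 * k) → ℕ) : Finset (Finset ℕ) →₀ ℚ :=
  ∑ ε : Fin k → Bool,
    ((-1 : ℚ) ^ (∑ i : Fin k, (ε i).toNat)) • Finsupp.single (Fface k x ε) 1

/-- Directed walks from `α` to `x`, encoded as `(m, v)` with `v : Fin (m+1) → Perm_I`. -/
def Walks (k : ℕ) (I : Finset ℕ) (α x : PermOn k I) :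
    Set ((m : ℕ) × (Fin (m + 1) → PermOn k I)) :=
  { w | 1 ≤ w.1 ∧ w.2 0 = α ∧ w.2 (Fin.last w.1) = x ∧
      (∀ j : ℕ, ∀ h : j < w.1,
        IsAlt k (w.2 ⟨j, by omega⟩).1 ∧
        Subordinate k (w.2 ⟨j, by omega⟩).1 (w.2 ⟨j + 1, by omega⟩).1) ∧
      (∀ j : ℕ, ∀ h : j + 1 < w.1, w.2 ⟨j, by omega⟩ ≠ w.2 ⟨j + 1, by omega⟩) }

/-- `s_I(α, x) = 1` if the unique `τ ∈ S^even_{2k}` with `τ·σ·α = x` is an even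
permutation, and `0` otherwise. -/
def sI (k : ℕ) (I : Finset ℕ) (α x : PermOn k I) : ℕ := by
  classical
  exact if (∃ (τ : Seven k) (σ : Sodd k),
      (∀ j, α.1 (σ.1 (τ.1 j)) = x.1 j) ∧ Equiv.Perm.sign τ.1 = 1)
    then 1 else 0

/-- The weight `wt` of a walk. -/
def wtW (k : ℕ) (I : Finset ℕ) (w : (m : ℕ) × (Fin (m + 1) → PermOn k I)) : ℕ :=
  ∑ j : Fin w.1, sI k I (w.2 j.castSucc) (w.2 j.succ)

/-- The topological coefficient `TCoef^α_x = −Σ_{p ∈ P_I(α,x)} (−1)^{wt(p)}`. -/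
def TCoef (k : ℕ) (I : Finset ℕ) (α x : PermOn k I) : ℚ :=
  - ∑ᶠ p ∈ Walks k I α x, (-1 : ℚ) ^ (wtW k I p)

/-- `z` is restrictable to `I₁` and `I₂`. -/
def Restrictable (k l : ℕ) (I₁ I₂ : Finset ℕ) (z : Fin (2 * (k + l)) → ℕ) : Prop :=
  ∀ i : ℕ, ∀ h : i < k + l,
    (z ⟨2 * i, by omega⟩ ∈ I₁ ∧ z ⟨2 * i + 1, by omega⟩ ∈ I₁) ∨
    (z ⟨2 * i, by omega⟩ ∈ I₂ ∧ z ⟨2 * i + 1, by omega⟩ ∈ I₂)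

/-- The map `Perm_I → Perm_{w(I)}`, `x ↦ w ∘ x`. -/
def wMap (k : ℕ) (I : Finset ℕ) (w : Equiv.Perm ℕ) (x : PermOn k I) :
    PermOn k (I.image w) :=
  ⟨fun j => w (x.1 j),
   fun a b hab => x.2.1 (w.injective hab),
   fun j => Finset.mem_image_of_mem w (x.2.2 j)⟩

end

theorem mem_Sset {k : ℕ} {x : Fin (2 * k) → ℕ} {j : Fin (2 * k)} {v : ℕ} :
    v ∈ Sset k x j ↔
      ∃ t : Fin (2 * k), (t = j ∨ (t : ℕ) < 2 * ((j : ℕ) / 2)) ∧ x t = v := by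
  simp only [Sset, Finset.mem_insert, Finset.mem_image, Finset.mem_filter, Finset.mem_univ,
    true_and]
  constructor
  · rintro (rfl | ⟨t, ht, rfl⟩)
    · exact ⟨j, Or.inl rfl, rfl⟩
    · exact ⟨t, Or.inr ht, rfl⟩
  · rintro ⟨t, rfl | ht, rfl⟩
    · exact Or.inl rfl
    · exact Or.inr ⟨t, ht, rfl⟩

/-- Subordination selects in each block of `y` a position `c` whose value, together with the
values of the preceding blocks, exhausts the values of `x` up to the start of the block. -/
theorem Subordinate.exists_choice {k : ℕ} {x y : Fin (2 * k) → ℕ} (h : Subordinate k x y)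
    {m : ℕ} (hm : m < k) :
    ∃ c d : Fin (2 * k),
      ((c : ℕ) = 2 * m ∧ (d : ℕ) = 2 * m + 1 ∨ (c : ℕ) = 2 * m + 1 ∧ (d : ℕ) = 2 * m) ∧
      ∀ v, (∃ t : Fin (2 * k), (t : ℕ) ≤ 2 * m ∧ x t = v) ↔
        ∃ t : Fin (2 * k), (t = c ∨ (t : ℕ) < 2 * m) ∧ y t = v := by
  have hx (v : ℕ) : v ∈ Sset k x ⟨2 * m, by omega⟩ ↔
      ∃ t : Fin (2 * k), (t : ℕ) ≤ 2 * m ∧ x t = v := by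
    rw [mem_Sset]
    refine exists_congr fun t => and_congr_left fun _ => ?_
    rw [Fin.ext_iff]
    dsimp only
    omega
  rcases h m hm with h | h
  · refine ⟨⟨2 * m, by omega⟩, ⟨2 * m + 1, by omega⟩, Or.inl ⟨rfl, rfl⟩, fun v => ?_⟩
    rw [← hx, h, mem_Sset]
    simp
  · refine ⟨⟨2 * m + 1, by omega⟩, ⟨2 * m, by omega⟩, Or.inr ⟨rfl, rfl⟩, fun v => ?_⟩
    rw [← hx, h, mem_Sset]
    simp [show (2 * m + 1) / 2 = m by omega]

theorem permLt_of_blockSum_lt {k : ℕ} {x y : Fin (2 * k) → ℕ} {m : ℕ} (hm : m < k)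
    (hlt : blockSum k x m hm < blockSum k y m hm)
    (heq : ∀ n (hn : n < k), m < n → blockSum k x n hn = blockSum k y n hn) :
    PermLt k x y := by
  refine ⟨k - 1 - m, by omega, ?_, fun i hi => heq _ _ (by omega)⟩
  simpa only [show k - 1 - (k - 1 - m) = m by omega] using hlt

/-- If `x` is subordinate to `y`, agrees with `y` after block `m`, and is not `≺`-below `y`,
then `x` agrees with `y` on block `m` as well. -/
theorem Subordinate.eq_on_block {k : ℕ} {x y : Fin (2 * k) → ℕ} (h : Subordinate k x y)
    (hy : Function.Injective y) (hxy : Set.range y ⊆ Set.range x)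
    (hxa : IsAlt k x) (hya : IsAlt k y) (hnot : ¬ PermLt k x y) {m : ℕ} (hm : m < k)
    (hagree : ∀ t : Fin (2 * k), 2 * m + 2 ≤ (t : ℕ) → x t = y t) :
    x ⟨2 * m, by omega⟩ = y ⟨2 * m, by omega⟩ ∧
      x ⟨2 * m + 1, by omega⟩ = y ⟨2 * m + 1, by omega⟩ := by
  obtain ⟨c, d, hcd, hmem⟩ := h.exists_choice hm
  have hd : x ⟨2 * m + 1, by omega⟩ = y d := by
    obtain ⟨s, hs⟩ := hxy ⟨d, rfl⟩
    have hs₁ : ¬ (s : ℕ) ≤ 2 * m := fun hle => by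
      obtain ⟨t, ht, hyt⟩ := (hmem (y d)).1 ⟨s, hle, hs⟩
      have := hy hyt
      subst this
      rcases ht with rfl | ht <;> omega
    have hs₂ : ¬ 2 * m + 2 ≤ (s : ℕ) := fun hge => by
      have := hy ((hagree s hge).symm.trans hs)
      subst this
      omega
    rw [← hs]
    congr 1
    ext
    dsimp only
    omega
  obtain ⟨s, hs, hsc⟩ := (hmem (y c)).2 ⟨c, Or.inl rfl, rfl⟩
  have hs₁ : 2 * m - 1 ≤ (s : ℕ) := by
    by_contra hlt
    obtain ⟨c', d', hcd', hmem'⟩ := h.exists_choice (m := m - 1) (by omega)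
    obtain ⟨t, ht, hyt⟩ := (hmem' (y c)).1 ⟨s, by omega, hsc⟩
    have := hy hyt
    subst this
    rcases ht with rfl | ht <;> omega
  have hc : x ⟨2 * m, by omega⟩ = y c := by
    by_contra hne
    have hs₂ : (s : ℕ) ≠ 2 * m := fun he => hne (by rw [← hsc]; congr 1; ext; exact he.symm)
    obtain ⟨n, rfl⟩ : ∃ n, m = n + 1 := ⟨m - 1, by omega⟩
    have hdesc := hxa.2 n hm
    have hsn : s = ⟨2 * n + 1, by omega⟩ := by ext; dsimp only; omega
    rw [← hsn, hsc] at hdesc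
    refine hnot (permLt_of_blockSum_lt hm ?_ fun j hj hlt => ?_)
    · have hsum : blockSum k y (n + 1) hm = y c + y d := by
        rcases hcd with ⟨h₁, h₂⟩ | ⟨h₁, h₂⟩
        · rw [Fin.eq_mk_iff_val_eq.2 h₁, Fin.eq_mk_iff_val_eq.2 h₂, blockSum]
        · rw [Fin.eq_mk_iff_val_eq.2 h₁, Fin.eq_mk_iff_val_eq.2 h₂, blockSum, add_comm]
      rw [hsum, ← hd]
      exact Nat.add_lt_add_right hdesc _
    · simp only [blockSum]
      rw [hagree _ (by dsimp only; omega), hagree _ (by dsimp only; omega)]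
  rcases hcd with ⟨h₁, h₂⟩ | ⟨h₁, h₂⟩
  · exact ⟨hc.trans (congrArg y (Fin.ext h₁)), hd.trans (congrArg y (Fin.ext h₂))⟩
  · have hltx := hxa.1 m hm
    have hlty := hya.1 m hm
    rw [hc, hd, show c = ⟨2 * m + 1, by omega⟩ from Fin.ext h₁,
      show d = ⟨2 * m, by omega⟩ from Fin.ext h₂] at hltx
    exact absurd hltx hlty.asymm

theorem PermOn.range_eq {k : ℕ} {I : Finset ℕ} (hI : I.card = 2 * k) (x : PermOn k I) :
    Set.range x.1 = I := by
  have himage : Finset.univ.image x.1 = I := by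
    refine Finset.eq_of_subset_of_card_le ?_ ?_
    · intro v hv
      obtain ⟨i, -, rfl⟩ := Finset.mem_image.1 hv
      exact x.2.2 i
    · rw [Finset.card_image_of_injective _ x.2.1, hI, Finset.card_univ, Fintype.card_fin]
  simpa using congrArg (fun J : Finset ℕ => (J : Set ℕ)) himage

/-- If `α ∈ Alt_I` is `≺`-maximal in `Alt_I`, then the only `β ∈ Alt_I`
with `α` subordinate to `β` is `β = α`. -/
theorem statement2 (k : ℕ) (hk : 1 ≤ k) (I : Finset ℕ) (hI : I.card = 2 * k)
    (α : PermOn k I) (hα : IsAlt k α.1)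
    (hmax : ∀ β : PermOn k I, IsAlt k β.1 → ¬ PermLt k α.1 β.1)
    (β : PermOn k I) (hβ : IsAlt k β.1) (hsub : Subordinate k α.1 β.1) :
    β = α := by
  have hagree : ∀ j ≤ k, ∀ t : Fin (2 * k), 2 * (k - j) ≤ (t : ℕ) → α.1 t = β.1 t := by
    intro j
    induction j with
    | zero => intro _ t ht; omega
    | succ j ih =>
      intro hj t ht
      have hafter (t : Fin (2 * k)) (ht : 2 * (k - (j + 1)) + 2 ≤ (t : ℕ)) :
          α.1 t = β.1 t := ih (by omega) t (by omega)
      by_cases hge : 2 * (k - (j + 1)) + 2 ≤ (t : ℕ)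
      · exact hafter t hge
      have hblock := hsub.eq_on_block β.2.1
        ((β.range_eq hI).trans (α.range_eq hI).symm).subset hα hβ (hmax β hβ)
        (by omega : k - (j + 1) < k) hafter
      obtain ht' | ht' : (t : ℕ) = 2 * (k - (j + 1)) ∨ (t : ℕ) = 2 * (k - (j + 1)) + 1 := by
        omega
      · simpa only [← ht'] using hblock.1
      · simpa only [← ht'] using hblock.2
  exact Subtype.ext (funext fun t => (hagree k le_rfl t (by omega)).symm)
end

section
/- The images of the alternating permutations Alt_I in the quotient ℚ⟨Perm_I⟩/M_I form a ℚ-basis; in particular, dim_ℚ(ℚ⟨Perm_I⟩/M_I) equals the number of alternating permutations on I. -/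
/-- Vectors that are triangular with respect to a family of linear functionals are
linearly independent. -/
theorem linearIndependent_of_triangular {ι K V : Type*} [Field K] [AddCommGroup V] [Module K V]
    (v : ι → V) (L : ι → V →ₗ[K] K) (ν : ι → ℕ) (hdiag : ∀ i, L i (v i) ≠ 0)
    (htri : ∀ i j, L i (v j) ≠ 0 → i = j ∨ ν j < ν i) : LinearIndependent K v := by
  classical
  rw [linearIndependent_iff']
  intro s c hc
  by_contra! hne
  obtain ⟨i₀, hi₀, hci₀⟩ := hne
  obtain ⟨i, hi, hmin⟩ := Finset.exists_min_image (s.filter fun i => c i ≠ 0) ν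
    ⟨i₀, Finset.mem_filter.2 ⟨hi₀, hci₀⟩⟩
  rw [Finset.mem_filter] at hi
  have h := congrArg (L i) hc
  rw [map_sum, map_zero, Finset.sum_eq_single i] at h
  · rw [map_smul, smul_eq_mul] at h
    exact (mul_ne_zero hi.2 (hdiag i)) h
  · intro j hj hji
    rw [map_smul, smul_eq_mul]
    by_contra hne
    have hcj : c j ≠ 0 := left_ne_zero_of_mul hne
    rcases htri i j (right_ne_zero_of_mul hne) with h | h
    · exact hji h.symm
    · exact absurd (hmin j (Finset.mem_filter.2 ⟨hj, hcj⟩)) (by omega)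
  · exact fun h => absurd hi.1 h

/-- Extension by zero of a tuple to all of `ℕ`. -/
def valAt (k : ℕ) (x : Fin (2 * k) → ℕ) (n : ℕ) : ℕ := if h : n < 2 * k then x ⟨n, h⟩ else 0

theorem valAt_of_lt {k : ℕ} (x : Fin (2 * k) → ℕ) {n : ℕ} (h : n < 2 * k) :
    valAt k x n = x ⟨n, h⟩ := dif_pos h

/-- The set of the first `n` values of `f`. -/
def seg (f : ℕ → ℕ) (n : ℕ) : Finset ℕ := (Finset.range n).image f

theorem seg_succ (f : ℕ → ℕ) (n : ℕ) : seg f (n + 1) = insert (f n) (seg f n) := by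
  simp [seg, Finset.range_add_one]

theorem seg_congr {f g : ℕ → ℕ} {m n : ℕ} (hmn : m ≤ n) (hm : seg f m = seg g m)
    (h : ∀ t, m ≤ t → f t = g t) : seg f n = seg g n := by
  induction n, hmn using Nat.le_induction with
  | base => exact hm
  | succ n hn ih => rw [seg_succ, seg_succ, ih, h n hn]

theorem seg_congr_left {f g : ℕ → ℕ} {n : ℕ} (h : ∀ t, t < n → f t = g t) :
    seg f n = seg g n :=
  Finset.image_congr fun t ht => h t (by simpa using ht)

/-- The contribution of block `i` of `f` to the coefficient of a chain of sets in `chain`: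
`1` or `-1` according to which of the two sets of block `i` is equal to `S`. -/
def blockCoeff (S : Finset ℕ) (f : ℕ → ℕ) (i : ℕ) : ℚ :=
  (if S = insert (f (2 * i)) (seg f (2 * i)) then 1 else 0) -
    (if S = insert (f (2 * i + 1)) (seg f (2 * i)) then 1 else 0)

/-- The coefficient of the face `{S 0, …, S (k - 1)}` in the chain of `f`. -/
def faceCoeff (k : ℕ) (S : ℕ → Finset ℕ) (f : ℕ → ℕ) : ℚ :=
  ∏ i ∈ Finset.range k, blockCoeff (S i) f i

theorem blockCoeff_congr {S : Finset ℕ} {f g : ℕ → ℕ} {i : ℕ} (h : seg f (2 * i) = seg g (2 * i))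
    (h₀ : f (2 * i) = g (2 * i)) (h₁ : f (2 * i + 1) = g (2 * i + 1)) :
    blockCoeff S f i = blockCoeff S g i := by
  simp only [blockCoeff, h, h₀, h₁]

theorem faceCoeff_swap {k i : ℕ} (hi : i < k) (S : ℕ → Finset ℕ) {f g : ℕ → ℕ}
    (h₀ : g (2 * i) = f (2 * i + 1)) (h₁ : g (2 * i + 1) = f (2 * i))
    (h : ∀ n, n ≠ 2 * i → n ≠ 2 * i + 1 → g n = f n) :
    faceCoeff k S g = - faceCoeff k S f := by
  have hi' : i ∈ Finset.range k := Finset.mem_range.2 hi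
  have hseg : seg g (2 * i) = seg f (2 * i) := seg_congr_left fun t ht => h t (by omega) (by omega)
  have hseg' : seg g (2 * i + 2) = seg f (2 * i + 2) := by
    rw [seg_succ, seg_succ, seg_succ, seg_succ, hseg, h₀, h₁, Finset.insert_comm]
  rw [faceCoeff, faceCoeff, ← Finset.mul_prod_erase _ _ hi', ← Finset.mul_prod_erase _ _ hi',
    ← neg_mul]
  congr 1
  · simp only [blockCoeff, hseg, h₀, h₁]
    ring
  · refine Finset.prod_congr rfl fun j hj => ?_
    have hji := Finset.ne_of_mem_erase hj
    refine blockCoeff_congr ?_ (h _ (by omega) (by omega)) (h _ (by omega) (by omega))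
    rcases lt_or_gt_of_ne hji with hlt | hlt
    · exact seg_congr_left fun t ht => h t (by omega) (by omega)
    · exact seg_congr (by omega) hseg' fun t ht => h t (by omega) (by omega)

/-- `upd4 f i p q r s` agrees with `f` except that it takes the values `p, q, r, s` at
`2i, 2i+1, 2i+2, 2i+3`. -/
def upd4 (f : ℕ → ℕ) (i p q r s : ℕ) (n : ℕ) : ℕ :=
  if n = 2 * i then p
  else if n = 2 * i + 1 then q
  else if n = 2 * i + 2 then r
  else if n = 2 * i + 3 then s
  else f n

section upd4

variable (f : ℕ → ℕ) (i p q r s : ℕ)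

theorem upd4_zero : upd4 f i p q r s (2 * i) = p := by simp [upd4]

theorem upd4_one : upd4 f i p q r s (2 * i + 1) = q := by simp [upd4]

theorem upd4_two : upd4 f i p q r s (2 * i + 2) = r := by simp [upd4]

theorem upd4_three : upd4 f i p q r s (2 * i + 3) = s := by simp [upd4]

theorem upd4_of_ne {n : ℕ} (h : n < 2 * i ∨ 2 * i + 3 < n) : upd4 f i p q r s n = f n := by
  grind [upd4]

theorem upd4_self :
    upd4 f i (f (2 * i)) (f (2 * i + 1)) (f (2 * i + 2)) (f (2 * i + 3)) = f := by
  ext n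
  grind [upd4]

theorem seg_upd4 : seg (upd4 f i p q r s) (2 * i) = seg f (2 * i) :=
  seg_congr_left fun _ ht => upd4_of_ne _ _ _ _ _ _ (.inl ht)

theorem seg_upd4_two : seg (upd4 f i p q r s) (2 * i + 2) = {p, q} ∪ seg f (2 * i) := by
  rw [seg_succ, seg_succ, seg_upd4, upd4_zero, upd4_one]
  ext; simp; tauto

theorem seg_upd4_four : seg (upd4 f i p q r s) (2 * i + 4) = {p, q, r, s} ∪ seg f (2 * i) := by
  rw [seg_succ, seg_succ, seg_upd4_two, upd4_two, upd4_three]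
  ext; simp; tauto

end upd4

theorem faceCoeff_upd4 {k i : ℕ} (hi : i + 1 < k) (S : ℕ → Finset ℕ) (f : ℕ → ℕ) (p q r s : ℕ)
    (hset : ({p, q, r, s} : Finset ℕ) =
      {f (2 * i), f (2 * i + 1), f (2 * i + 2), f (2 * i + 3)}) :
    faceCoeff k S (upd4 f i p q r s) =
      ((if S i = insert p (seg f (2 * i)) then 1 else 0) -
        (if S i = insert q (seg f (2 * i)) then 1 else 0)) *
      ((if S (i + 1) = {p, q, r} ∪ seg f (2 * i) then 1 else 0) -
        (if S (i + 1) = {p, q, s} ∪ seg f (2 * i) then 1 else 0)) *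
      ∏ j ∈ ((Finset.range k).erase i).erase (i + 1), blockCoeff (S j) f j := by
  have hi' : i ∈ Finset.range k := Finset.mem_range.2 (by omega)
  have hi'' : i + 1 ∈ (Finset.range k).erase i := by simp [hi]
  have hins : ∀ t : ℕ, insert t ({p, q} ∪ seg f (2 * i)) = {p, q, t} ∪ seg f (2 * i) := by
    intro t; ext; simp; tauto
  rw [faceCoeff, ← Finset.mul_prod_erase _ _ hi', ← Finset.mul_prod_erase _ _ hi'', ← mul_assoc]
  congr 1
  · congr 1
    · rw [blockCoeff, upd4_zero, upd4_one, seg_upd4]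
    · rw [blockCoeff, show 2 * (i + 1) = 2 * i + 2 by ring, upd4_two, upd4_three, seg_upd4_two,
        hins, hins]
  · refine Finset.prod_congr rfl fun j hj => ?_
    have hj₁ := Finset.ne_of_mem_erase hj
    have hj₀ := Finset.ne_of_mem_erase (Finset.mem_of_mem_erase hj)
    refine blockCoeff_congr ?_ (upd4_of_ne _ _ _ _ _ _ (by omega))
      (upd4_of_ne _ _ _ _ _ _ (by omega))
    rcases lt_or_gt_of_ne hj₀ with hlt | hlt
    · exact seg_congr_left fun t ht => upd4_of_ne _ _ _ _ _ _ (by omega)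
    · refine seg_congr (m := 2 * i + 4) (by omega) ?_
        fun t ht => upd4_of_ne _ _ _ _ _ _ (by omega)
      rw [seg_upd4_four, hset, ← seg_upd4_four, upd4_self]

theorem faceCoeff_garnir {k i : ℕ} (hi : i + 1 < k) (S : ℕ → Finset ℕ) (f : ℕ → ℕ) {a b c d : ℕ}
    (ha : f (2 * i) = a) (hb : f (2 * i + 1) = b) (hc : f (2 * i + 2) = c)
    (hd : f (2 * i + 3) = d) :
    faceCoeff k S f - faceCoeff k S (upd4 f i a c b d) + faceCoeff k S (upd4 f i a d b c)
      + faceCoeff k S (upd4 f i b c a d) - faceCoeff k S (upd4 f i b d a c)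
      + faceCoeff k S (upd4 f i c d a b) = 0 := by
  have hf : faceCoeff k S f = faceCoeff k S (upd4 f i a b c d) := by
    rw [← ha, ← hb, ← hc, ← hd, upd4_self]
  have rot : ∀ u v w : ℕ, ({u, v, w} : Finset ℕ) = {v, w, u} := by intros; ext; simp; tauto
  have flip : ∀ u v w : ℕ, ({u, v, w} : Finset ℕ) = {u, w, v} := by intros; ext; simp; tauto
  rw [hf]
  rw [faceCoeff_upd4 hi, faceCoeff_upd4 hi, faceCoeff_upd4 hi, faceCoeff_upd4 hi,
    faceCoeff_upd4 hi, faceCoeff_upd4 hi]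
  · rw [flip a c b, flip a d b, flip a d c, rot b c a, rot c a b, flip b d c, rot b d a,
      rot d a b, rot c d a, rot d a c, rot c d b, rot d b c]
    ring
  all_goals rw [ha, hb, hc, hd]
  all_goals
    ext
    simp only [Finset.mem_insert, Finset.mem_singleton]
    tauto

theorem valAt_set4 {k i : ℕ} (hi : i + 1 < k) (x : Fin (2 * k) → ℕ) (p q r s : ℕ) :
    valAt k (set4 k x i p q r s) = upd4 (valAt k x) i p q r s := by
  ext n
  simp only [valAt, upd4, set4]
  split_ifs <;> first | rfl | omega

theorem valAt_comp_swap {k i : ℕ} (hi : i < k) (x : Fin (2 * k) → ℕ) :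
    let y := x ∘ Equiv.swap (⟨2 * i, by omega⟩ : Fin (2 * k)) ⟨2 * i + 1, by omega⟩
    valAt k y (2 * i) = valAt k x (2 * i + 1) ∧ valAt k y (2 * i + 1) = valAt k x (2 * i) ∧
      ∀ n, n ≠ 2 * i → n ≠ 2 * i + 1 → valAt k y n = valAt k x n := by
  refine ⟨?_, ?_, fun n h₀ h₁ => ?_⟩
  · rw [valAt_of_lt _ (by omega), valAt_of_lt _ (by omega)]
    simp
  · rw [valAt_of_lt _ (by omega), valAt_of_lt _ (by omega)]
    simp
  · unfold valAt
    split_ifs with h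
    · rw [Function.comp_apply, Equiv.swap_apply_of_ne_of_ne] <;> simpa [Fin.ext_iff]
    · rfl

/-- The functional on `ℚ⟨Perm_I⟩` giving the coefficient of the face `S` in the chain. -/
noncomputable def faceFunctional (k : ℕ) (I : Finset ℕ) (S : ℕ → Finset ℕ) : (PermOn k I →₀ ℚ) →ₗ[ℚ] ℚ :=
  Finsupp.linearCombination ℚ fun x => faceCoeff k S (valAt k x.1)

theorem faceFunctional_single (k : ℕ) (I : Finset ℕ) (S : ℕ → Finset ℕ) (x : PermOn k I) :
    faceFunctional k I S (Finsupp.single x 1) = faceCoeff k S (valAt k x.1) := by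
  simp [faceFunctional]

theorem MI_le_ker_faceFunctional (k : ℕ) (I : Finset ℕ) (S : ℕ → Finset ℕ) :
    MI k I ≤ LinearMap.ker (faceFunctional k I S) := by
  refine Submodule.span_le.2 ?_
  rintro v (⟨x, x', i, hi, hx', rfl⟩ | ⟨x, y₁, y₂, y₃, y₄, y₅, i, hi, ⟨h₁, h₂, h₃, h₄, h₅⟩, rfl⟩)
  · obtain ⟨h₀, h₁, h⟩ := valAt_comp_swap hi x.1
    rw [← hx'] at h₀ h₁ h
    simp [faceFunctional_single, faceCoeff_swap hi S h₀ h₁ h]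
  · have := faceCoeff_garnir hi S (valAt k x.1) (valAt_of_lt _ (by omega))
      (valAt_of_lt _ (by omega)) (valAt_of_lt _ (by omega)) (valAt_of_lt _ (by omega))
    simpa [faceFunctional_single, h₁, h₂, h₃, h₄, h₅, valAt_set4 hi] using this

/-- The chain of sets `S^b_1, S^b_3, …` attached to `b`. -/
def oddSeg (b : ℕ → ℕ) (i : ℕ) : Finset ℕ := insert (b (2 * i)) (seg b (2 * i))

theorem oddSeg_eq_of_faceCoeff_ne_zero {k : ℕ} {S : ℕ → Finset ℕ} {f : ℕ → ℕ}
    (h : faceCoeff k S f ≠ 0) {i : ℕ} (hi : i < k) :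
    S i = insert (f (2 * i)) (seg f (2 * i)) ∨ S i = insert (f (2 * i + 1)) (seg f (2 * i)) := by
  have := Finset.prod_ne_zero_iff.1 h i (Finset.mem_range.2 hi)
  by_contra! hne
  simp [blockCoeff, hne.1, hne.2] at this

theorem notMem_seg {f : ℕ → ℕ} {N m n : ℕ} (hf : Set.InjOn f (Set.Iio N)) (hn : n < N)
    (hm : m ≤ n) : f n ∉ seg f m := by
  simp only [seg, Finset.mem_image, Finset.mem_range, not_exists, not_and]
  intro t ht h
  have : t = n := hf (Set.mem_Iio.2 (by omega)) (Set.mem_Iio.2 hn) h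
  omega

theorem faceCoeff_oddSeg_self {k : ℕ} {f : ℕ → ℕ} (hf : Set.InjOn f (Set.Iio (2 * k))) :
    faceCoeff k (oddSeg f) f = 1 := by
  refine Finset.prod_eq_one fun i hi => ?_
  rw [Finset.mem_range] at hi
  have hne : oddSeg f i ≠ insert (f (2 * i + 1)) (seg f (2 * i)) := by
    intro h
    have hmem : f (2 * i + 1) ∈ oddSeg f i := h ▸ Finset.mem_insert_self _ _
    exact notMem_seg hf (m := 2 * i + 1) (n := 2 * i + 1) (by omega) le_rfl
      (by rwa [seg_succ])
  rw [blockCoeff, if_neg hne, if_pos (by rfl), sub_zero]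

/-- The sum of the values of `f` over all proper even initial segments. -/
def segWeight (k : ℕ) (f : ℕ → ℕ) : ℕ := ∑ i ∈ Finset.range k, ∑ v ∈ seg f (2 * i), v

/-- If the odd sets of an alternating `b` form a face of the chain of `f`, then every even
initial segment of `f` is equal to that of `b` or has smaller sum. -/
theorem seg_eq_or_sum_lt {k : ℕ} {b f : ℕ → ℕ} (hb : Set.InjOn b (Set.Iio (2 * k)))
    (hf : Set.InjOn f (Set.Iio (2 * k)))
    (halt : ∀ i, i + 1 < k → b (2 * i + 2) < b (2 * i + 1))
    (h : faceCoeff k (oddSeg b) f ≠ 0) {i : ℕ} (hi : i < k) :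
    seg f (2 * i) = seg b (2 * i) ∨ ∑ v ∈ seg f (2 * i), v < ∑ v ∈ seg b (2 * i), v := by
  obtain _ | i := i
  · left; simp [seg]
  have hf₀ : f (2 * i) ∉ seg f (2 * i) := notMem_seg hf (by omega) le_rfl
  have hf₁ : f (2 * i + 1) ∉ seg f (2 * i) := notMem_seg hf (by omega) (by omega)
  have hff : f (2 * i) ≠ f (2 * i + 1) := fun e => by
    have := hf (Set.mem_Iio.2 (by omega)) (Set.mem_Iio.2 (by omega)) e
    omega
  have hsegb : seg b (2 * i + 2) = insert (b (2 * i + 1)) (oddSeg b i) := by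
    rw [seg_succ, seg_succ, oddSeg]
  have hb₁ : b (2 * i + 1) ∉ oddSeg b i := by
    rw [oddSeg, ← seg_succ]
    exact notMem_seg hb (by omega) le_rfl
  obtain ⟨z, hz, hzseg⟩ : ∃ z, z ∉ oddSeg b i ∧ seg f (2 * i + 2) = insert z (oddSeg b i) := by
    rcases oddSeg_eq_of_faceCoeff_ne_zero h (i := i) (by omega) with e | e
    · exact ⟨f (2 * i + 1), by simp [e, hf₁, hff.symm], by rw [e, seg_succ, seg_succ]⟩
    · exact ⟨f (2 * i), by simp [e, hf₀, hff],
        by rw [e, seg_succ, seg_succ, Finset.insert_comm]⟩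
  have hz' : z ∈ oddSeg b (i + 1) := by
    have hzf : z ∈ seg f (2 * (i + 1)) := by
      rw [mul_add, mul_one, hzseg]
      exact Finset.mem_insert_self _ _
    rcases oddSeg_eq_of_faceCoeff_ne_zero h hi with e | e <;>
      exact e ▸ Finset.mem_insert_of_mem hzf
  rw [mul_add, mul_one]
  rw [oddSeg, mul_add, mul_one, hsegb] at hz'
  rw [hzseg, hsegb, Finset.sum_insert hz, Finset.sum_insert hb₁]
  have hlt := halt i hi
  rcases Finset.mem_insert.1 hz' with e | e
  · right; omega
  · rcases Finset.mem_insert.1 e with e | e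
    · left; rw [e]
    · exact absurd e hz

theorem eq_or_segWeight_lt {k : ℕ} {b f : ℕ → ℕ} (hb : Set.InjOn b (Set.Iio (2 * k)))
    (hf : Set.InjOn f (Set.Iio (2 * k)))
    (halt : ∀ i, i + 1 < k → b (2 * i + 2) < b (2 * i + 1))
    (hbasc : ∀ i, i < k → b (2 * i) < b (2 * i + 1))
    (hfasc : ∀ i, i < k → f (2 * i) < f (2 * i + 1))
    (himg : seg f (2 * k) = seg b (2 * k))
    (h : faceCoeff k (oddSeg b) f ≠ 0) :
    (∀ n, n < 2 * k → b n = f n) ∨ segWeight k f < segWeight k b := by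
  have key : ∀ i, i < k → _ := fun i hi => seg_eq_or_sum_lt hb hf halt h hi
  by_cases hseg : ∀ i, i < k → seg f (2 * i) = seg b (2 * i)
  · left
    have hblock : ∀ i, i < k → b (2 * i) = f (2 * i) ∧ b (2 * i + 1) = f (2 * i + 1) := by
      intro i hi
      have hnext : seg f (2 * i + 2) = seg b (2 * i + 2) := by
        rcases Nat.lt_or_ge (i + 1) k with hlt | hge
        · exact hseg (i + 1) hlt
        · obtain rfl : k = i + 1 := by omega
          exact himg
      have hb₀ : b (2 * i) ∉ seg f (2 * i) := hseg i hi ▸ notMem_seg hb (by omega) le_rfl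
      have hb₁ : b (2 * i + 1) ∉ seg f (2 * i) :=
        hseg i hi ▸ notMem_seg hb (by omega) (by omega)
      have m₀ : b (2 * i) ∈ seg f (2 * i + 2) := by rw [hnext]; simp [seg_succ]
      have m₁ : b (2 * i + 1) ∈ seg f (2 * i + 2) := by rw [hnext]; simp [seg_succ]
      simp only [seg_succ, Finset.mem_insert, hb₀, hb₁, or_false] at m₀ m₁
      have := hbasc i hi
      have := hfasc i hi
      omega
    intro n hn
    obtain ⟨h₀, h₁⟩ := hblock (n / 2) (by omega)
    rcases Nat.mod_two_eq_zero_or_one n with hp | hp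
    · rwa [show 2 * (n / 2) = n by omega] at h₀
    · rwa [show 2 * (n / 2) + 1 = n by omega] at h₁
  · right
    push Not at hseg
    obtain ⟨i, hi, hne⟩ := hseg
    refine Finset.sum_lt_sum (fun j hj => ?_)
      ⟨i, Finset.mem_range.2 hi, (key i hi).resolve_left hne⟩
    rcases key j (Finset.mem_range.1 hj) with e | e
    · rw [e]
    · exact e.le

theorem injOn_valAt {k : ℕ} {I : Finset ℕ} (x : PermOn k I) :
    Set.InjOn (valAt k x.1) (Set.Iio (2 * k)) := by
  intro m hm n hn h
  rw [valAt_of_lt _ hm, valAt_of_lt _ hn] at h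
  exact congrArg Fin.val (x.2.1 h)

theorem seg_valAt {k : ℕ} {I : Finset ℕ} (hI : I.card = 2 * k) (x : PermOn k I) :
    seg (valAt k x.1) (2 * k) = I := by
  refine Finset.eq_of_subset_of_card_le (fun v hv => ?_) ?_
  · simp only [seg, Finset.mem_image, Finset.mem_range] at hv
    obtain ⟨n, hn, rfl⟩ := hv
    rw [valAt_of_lt _ hn]
    exact x.2.2 _
  · rw [seg, Finset.card_image_of_injOn (by simpa using injOn_valAt x), Finset.card_range, hI]

theorem isAlt_iff_valAt {k : ℕ} (x : Fin (2 * k) → ℕ) :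
    IsAlt k x ↔ (∀ i, i < k → valAt k x (2 * i) < valAt k x (2 * i + 1)) ∧
      ∀ i, i + 1 < k → valAt k x (2 * i + 2) < valAt k x (2 * i + 1) := by
  refine and_congr (forall₂_congr fun i hi => ?_) (forall₂_congr fun i hi => ?_) <;>
    rw [valAt_of_lt _ (by omega), valAt_of_lt _ (by omega)]

theorem linearIndependent_mkQ_alt (k : ℕ) (I : Finset ℕ) (hI : I.card = 2 * k) :
    LinearIndependent ℚ (fun a : {a : PermOn k I // IsAlt k a.1} =>
      (MI k I).mkQ (Finsupp.single a.1 (1 : ℚ))) := by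
  have happly : ∀ (b : PermOn k I) (a : PermOn k I),
      (MI k I).liftQ _ (MI_le_ker_faceFunctional k I (oddSeg (valAt k b.1)))
        ((MI k I).mkQ (Finsupp.single a (1 : ℚ))) =
      faceCoeff k (oddSeg (valAt k b.1)) (valAt k a.1) := fun b a => by
    rw [Submodule.mkQ_apply, Submodule.liftQ_apply, faceFunctional_single]
  refine linearIndependent_of_triangular _
    (fun b => (MI k I).liftQ _ (MI_le_ker_faceFunctional k I (oddSeg (valAt k b.1.1))))
    (fun a => segWeight k (valAt k a.1.1)) (fun a => ?_) (fun b a hba => ?_)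
  · rw [happly, faceCoeff_oddSeg_self (injOn_valAt a.1)]
    exact one_ne_zero
  · rw [happly] at hba
    have hb := (isAlt_iff_valAt _).1 b.2
    have ha := (isAlt_iff_valAt _).1 a.2
    refine (eq_or_segWeight_lt (injOn_valAt b.1) (injOn_valAt a.1) hb.2 hb.1 ha.1
      (by rw [seg_valAt hI, seg_valAt hI]) hba).imp_left fun h => ?_
    refine Subtype.ext (Subtype.ext (funext fun j => ?_))
    have := h j j.2
    rwa [valAt_of_lt _ j.2, valAt_of_lt _ j.2] at this

/-- The statistic decreased by straightening: the `i`-th block contributes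
`(2i+1) f(2i) + 2i f(2i+1)`. -/
def straightenWeight (k : ℕ) (f : ℕ → ℕ) : ℕ :=
  ∑ i ∈ Finset.range k, ((2 * i + 1) * f (2 * i) + 2 * i * f (2 * i + 1))

theorem straightenWeight_swap_lt {k i : ℕ} (hi : i < k) {f g : ℕ → ℕ}
    (h₀ : g (2 * i) = f (2 * i + 1)) (h₁ : g (2 * i + 1) = f (2 * i))
    (h : ∀ n, n ≠ 2 * i → n ≠ 2 * i + 1 → g n = f n) (hlt : f (2 * i + 1) < f (2 * i)) :
    straightenWeight k g < straightenWeight k f := by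
  refine Finset.sum_lt_sum (fun j _ => ?_) ⟨i, Finset.mem_range.2 hi, ?_⟩
  · rcases eq_or_ne j i with rfl | hj
    · rw [h₀, h₁]; nlinarith
    · rw [h _ (by omega) (by omega), h _ (by omega) (by omega)]
  · rw [h₀, h₁]; nlinarith

theorem straightenWeight_upd4_lt {k i : ℕ} (hi : i + 1 < k) (f : ℕ → ℕ) {p q r s : ℕ}
    (hsum : p + q + r + s = f (2 * i) + f (2 * i + 1) + f (2 * i + 2) + f (2 * i + 3))
    (hlt : p + 3 * r + 2 * s < f (2 * i) + 3 * f (2 * i + 2) + 2 * f (2 * i + 3)) :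
    straightenWeight k (upd4 f i p q r s) < straightenWeight k f := by
  have hi' : i ∈ Finset.range k := Finset.mem_range.2 (by omega)
  have hi'' : i + 1 ∈ (Finset.range k).erase i := by simp [hi]
  have hrest : ∑ j ∈ ((Finset.range k).erase i).erase (i + 1),
        ((2 * j + 1) * upd4 f i p q r s (2 * j) + 2 * j * upd4 f i p q r s (2 * j + 1)) =
      ∑ j ∈ ((Finset.range k).erase i).erase (i + 1),
        ((2 * j + 1) * f (2 * j) + 2 * j * f (2 * j + 1)) := by
    refine Finset.sum_congr rfl fun j hj => ?_
    have hj₁ := Finset.ne_of_mem_erase hj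
    have hj₀ := Finset.ne_of_mem_erase (Finset.mem_of_mem_erase hj)
    rw [upd4_of_ne _ _ _ _ _ _ (by omega), upd4_of_ne _ _ _ _ _ _ (by omega)]
  rw [straightenWeight, straightenWeight, ← Finset.add_sum_erase _ _ hi',
    ← Finset.add_sum_erase _ _ hi'', ← Finset.add_sum_erase _ _ hi',
    ← Finset.add_sum_erase _ _ hi'', hrest]
  simp only [show 2 * (i + 1) = 2 * i + 2 by ring, upd4_zero, upd4_one, upd4_two, upd4_three]
  nlinarith

/-- Rearranging the values of a permutation on two consecutive blocks gives a permutation. -/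
theorem exists_permOn_set4 {k i : ℕ} (hi : i + 1 < k) {I : Finset ℕ} (x : PermOn k I)
    {p q r s : ℕ} (hset : ({p, q, r, s} : Finset ℕ) =
      {x.1 ⟨2 * i, by omega⟩, x.1 ⟨2 * i + 1, by omega⟩, x.1 ⟨2 * i + 2, by omega⟩,
        x.1 ⟨2 * i + 3, by omega⟩})
    (hnd : [p, q, r, s].Nodup) : ∃ y : PermOn k I, y.1 = set4 k x.1 i p q r s := by
  have hmem : ∀ v ∈ ({p, q, r, s} : Finset ℕ), v ∈ I ∧ ∀ j : Fin (2 * k), x.1 j = v →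
      2 * i ≤ j ∧ (j : ℕ) ≤ 2 * i + 3 := by
    intro v hv
    rw [hset] at hv
    simp only [Finset.mem_insert, Finset.mem_singleton] at hv
    rcases hv with rfl | rfl | rfl | rfl <;>
      exact ⟨x.2.2 _, fun j hj => by have := congrArg Fin.val (x.2.1 hj); simp at this; omega⟩
  have hp := hmem p (by simp)
  have hq := hmem q (by simp)
  have hr := hmem r (by simp)
  have hs := hmem s (by simp)
  simp only [List.nodup_cons, List.mem_cons, not_or, List.not_mem_nil] at hnd
  refine ⟨⟨set4 k x.1 i p q r s, fun u v huv => ?_, fun j => ?_⟩, rfl⟩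
  · have hinj := @x.2.1 u v
    rw [Fin.ext_iff] at hinj ⊢
    have outside : ∀ w : Fin (2 * k), (w : ℕ) ≠ 2 * i → (w : ℕ) ≠ 2 * i + 1 →
        (w : ℕ) ≠ 2 * i + 2 → (w : ℕ) ≠ 2 * i + 3 →
        x.1 w ≠ p ∧ x.1 w ≠ q ∧ x.1 w ≠ r ∧ x.1 w ≠ s := by
      intro w h₀ h₁ h₂ h₃
      refine ⟨fun e => ?_, fun e => ?_, fun e => ?_, fun e => ?_⟩
      · have := hp.2 w e; omega
      · have := hq.2 w e; omega
      · have := hr.2 w e; omega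
      · have := hs.2 w e; omega
    have hu := outside u
    have hv := outside v
    unfold set4 at huv
    clear hset hmem hp hq hr hs outside
    split_ifs at huv <;> grind
  · have := x.2.2 j
    unfold set4
    split_ifs <;> tauto

theorem mkQ_single_mem_span_alt (k : ℕ) (I : Finset ℕ) (x : PermOn k I) :
    (MI k I).mkQ (Finsupp.single x (1 : ℚ)) ∈
      Submodule.span ℚ (Set.range (fun a : {a : PermOn k I // IsAlt k a.1} =>
        (MI k I).mkQ (Finsupp.single a.1 (1 : ℚ)))) := by
  induction hN : straightenWeight k (valAt k x.1) using Nat.strong_induction_on generalizing x with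
  | _ N ih =>
  subst hN
  replace ih := fun y hy => ih _ hy y rfl
  by_cases hx : IsAlt k x.1
  · exact Submodule.subset_span ⟨⟨x, hx⟩, rfl⟩
  by_cases hasc : ∀ i, i < k → valAt k x.1 (2 * i) < valAt k x.1 (2 * i + 1)
  · have hdesc : ¬ ∀ i, i + 1 < k → valAt k x.1 (2 * i + 2) < valAt k x.1 (2 * i + 1) :=
      fun h => hx ((isAlt_iff_valAt _).2 ⟨hasc, h⟩)
    push Not at hdesc
    obtain ⟨i, hi, hbc⟩ := hdesc
    have hab := hasc i (by omega)
    have hcd := hasc (i + 1) hi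
    have hbc' : valAt k x.1 (2 * i + 1) ≠ valAt k x.1 (2 * i + 2) := fun e => by
      have := injOn_valAt x (Set.mem_Iio.2 (by omega)) (Set.mem_Iio.2 (by omega)) e
      omega
    have ha := valAt_of_lt x.1 (n := 2 * i) (by omega)
    have hb := valAt_of_lt x.1 (n := 2 * i + 1) (by omega)
    have hc := valAt_of_lt x.1 (n := 2 * i + 2) (by omega)
    have hd := valAt_of_lt x.1 (n := 2 * i + 3) (by omega)
    rw [show 2 * (i + 1) = 2 * i + 2 by ring] at hcd
    have step : ∀ {p q r s : ℕ}, ({p, q, r, s} : Finset ℕ) =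
        {x.1 ⟨2 * i, by omega⟩, x.1 ⟨2 * i + 1, by omega⟩, x.1 ⟨2 * i + 2, by omega⟩,
          x.1 ⟨2 * i + 3, by omega⟩} → [p, q, r, s].Nodup →
        p + q + r + s = valAt k x.1 (2 * i) + valAt k x.1 (2 * i + 1) + valAt k x.1 (2 * i + 2)
          + valAt k x.1 (2 * i + 3) →
        p + 3 * r + 2 * s < valAt k x.1 (2 * i) + 3 * valAt k x.1 (2 * i + 2)
          + 2 * valAt k x.1 (2 * i + 3) →
        ∃ y : PermOn k I, y.1 = set4 k x.1 i p q r s ∧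
          (MI k I).mkQ (Finsupp.single y (1 : ℚ)) ∈
            Submodule.span ℚ (Set.range (fun a : {a : PermOn k I // IsAlt k a.1} =>
              (MI k I).mkQ (Finsupp.single a.1 (1 : ℚ)))) := by
      intro p q r s hset hnd hsum hlt
      obtain ⟨y, hy⟩ := exists_permOn_set4 hi x hset hnd
      refine ⟨y, hy, ih y ?_⟩
      rw [hy, valAt_set4 hi]
      exact straightenWeight_upd4_lt hi _ hsum hlt
    rw [ha, hb, hc, hd] at step
    rw [ha, hb] at hab
    rw [hb, hc] at hbc hbc'
    rw [hc, hd] at hcd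
    generalize haa : x.1 ⟨2 * i, by omega⟩ = a at *
    generalize hbb : x.1 ⟨2 * i + 1, by omega⟩ = b at *
    generalize hcc : x.1 ⟨2 * i + 2, by omega⟩ = c at *
    generalize hdd : x.1 ⟨2 * i + 3, by omega⟩ = d at *
    obtain ⟨y₁, e₁, m₁⟩ := @step a c b d (by ext; simp; tauto)
      (by simp; omega) (by omega) (by omega)
    obtain ⟨y₂, e₂, m₂⟩ := @step a d b c (by ext; simp; tauto)
      (by simp; omega) (by omega) (by omega)
    obtain ⟨y₃, e₃, m₃⟩ := @step b c a d (by ext; simp; tauto)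
      (by simp; omega) (by omega) (by omega)
    obtain ⟨y₄, e₄, m₄⟩ := @step b d a c (by ext; simp; tauto)
      (by simp; omega) (by omega) (by omega)
    obtain ⟨y₅, e₅, m₅⟩ := @step c d a b (by ext; simp; tauto)
      (by simp; omega) (by omega) (by omega)
    have hG : Finsupp.single x (1 : ℚ) - Finsupp.single y₁ 1 + Finsupp.single y₂ 1
        + Finsupp.single y₃ 1 - Finsupp.single y₄ 1 + Finsupp.single y₅ 1 ∈ MI k I := by
      refine Submodule.subset_span (.inr ⟨x, y₁, y₂, y₃, y₄, y₅, i, hi, ?_, rfl⟩)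
      rw [haa, hbb, hcc, hdd]
      exact ⟨e₁, e₂, e₃, e₄, e₅⟩
    have h0 := (Submodule.Quotient.mk_eq_zero _).2 hG
    rw [← Submodule.mkQ_apply] at h0
    simp only [map_add, map_sub] at h0
    have : (MI k I).mkQ (Finsupp.single x (1 : ℚ)) =
        (MI k I).mkQ (Finsupp.single y₁ 1) - (MI k I).mkQ (Finsupp.single y₂ 1)
        - (MI k I).mkQ (Finsupp.single y₃ 1) + (MI k I).mkQ (Finsupp.single y₄ 1)
        - (MI k I).mkQ (Finsupp.single y₅ 1) := by
      rw [← sub_eq_zero, ← h0]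
      abel
    rw [this]
    exact sub_mem (add_mem (sub_mem (sub_mem m₁ m₂) m₃) m₄) m₅
  · push Not at hasc
    obtain ⟨i, hi, hle⟩ := hasc
    have hne : valAt k x.1 (2 * i + 1) ≠ valAt k x.1 (2 * i) := fun e => by
      have := injOn_valAt x (Set.mem_Iio.2 (by omega)) (Set.mem_Iio.2 (by omega)) e
      omega
    obtain ⟨h₀, h₁, h⟩ := valAt_comp_swap hi x.1
    let y : PermOn k I :=
      ⟨x.1 ∘ Equiv.swap (⟨2 * i, by omega⟩ : Fin (2 * k)) ⟨2 * i + 1, by omega⟩,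
        x.2.1.comp (Equiv.injective _), fun j => x.2.2 _⟩
    have hy := ih y (straightenWeight_swap_lt hi h₀ h₁ h (lt_of_le_of_ne hle hne))
    have hS : Finsupp.single x (1 : ℚ) + Finsupp.single y 1 ∈ MI k I :=
      Submodule.subset_span (.inl ⟨x, y, i, hi, rfl, rfl⟩)
    have h0 := (Submodule.Quotient.mk_eq_zero _).2 hS
    rw [← Submodule.mkQ_apply, map_add] at h0
    rw [eq_neg_of_add_eq_zero_left h0]
    exact neg_mem hy

theorem span_mkQ_alt_eq_top (k : ℕ) (I : Finset ℕ) :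
    Submodule.span ℚ (Set.range (fun a : {a : PermOn k I // IsAlt k a.1} =>
      (MI k I).mkQ (Finsupp.single a.1 (1 : ℚ)))) = ⊤ := by
  rw [eq_top_iff]
  rintro w -
  obtain ⟨v, rfl⟩ := (MI k I).mkQ_surjective w
  induction v using Finsupp.induction_linear with
  | zero => simp
  | add u v hu hv => rw [map_add]; exact add_mem hu hv
  | single x c =>
    have hc : Finsupp.single x c = c • Finsupp.single x (1 : ℚ) := by simp
    rw [hc, map_smul]
    exact Submodule.smul_mem _ _ (mkQ_single_mem_span_alt k I x)

/-- The images of `Alt_I` in `ℚ⟨Perm_I⟩/M_I` form a `ℚ`-basis: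
they are linearly independent and span the quotient. -/
theorem statement7 (k : ℕ) (hk : 1 ≤ k) (I : Finset ℕ) (hI : I.card = 2 * k) :
    LinearIndependent ℚ (fun a : {a : PermOn k I // IsAlt k a.1} =>
      (MI k I).mkQ (Finsupp.single a.1 (1 : ℚ))) ∧
    Submodule.span ℚ (Set.range (fun a : {a : PermOn k I // IsAlt k a.1} =>
      (MI k I).mkQ (Finsupp.single a.1 (1 : ℚ)))) = ⊤ := by
  exact ⟨linearIndependent_mkQ_alt k I hI, span_mkQ_alt_eq_top k I⟩
end

section
/- For all α, β ∈ Alt_I, the topological coefficient satisfies TC^α_β = 1 if α = β and TC^α_β = 0 otherwise. -/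
open Classical

section AlternatingPotential

variable {k : ℕ} {x y : Fin (2 * k) → ℕ}

lemma mem_Sset_even {i : ℕ} (h : 2 * i < 2 * k) {a : ℕ} :
    a ∈ Sset k x ⟨2 * i, h⟩ ↔ ∃ t : Fin (2 * k), (t : ℕ) ≤ 2 * i ∧ x t = a := by
  simp only [Sset, Finset.mem_insert, Finset.mem_image, Finset.mem_filter, Finset.mem_univ,
    true_and]
  constructor
  · rintro (rfl | ⟨t, ht, rfl⟩)
    · exact ⟨_, le_rfl, rfl⟩
    · exact ⟨t, by omega, rfl⟩
  · rintro ⟨t, ht, rfl⟩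
    rcases ht.eq_or_lt with h' | h'
    · left
      congr 1
      exact Fin.ext h'
    · exact Or.inr ⟨t, by omega, rfl⟩

lemma sum_Sset (hx : Function.Injective x) (j : Fin (2 * k)) :
    ∑ a ∈ Sset k x j, a =
      x j + ∑ a ∈ (Finset.univ.filter
        (fun t : Fin (2 * k) => (t : ℕ) < 2 * ((j : ℕ) / 2))).image x, a := by
  rw [Sset, Finset.sum_insert]
  simp only [Finset.mem_image, Finset.mem_filter, Finset.mem_univ, true_and, not_exists, not_and]
  intro t ht h
  have := hx h
  subst this
  omega

lemma sum_Sset_even_lt_odd (hy : Function.Injective y) (hya : IsAlt k y) {i : ℕ} (h : i < k) :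
    ∑ a ∈ Sset k y ⟨2 * i, by omega⟩, a < ∑ a ∈ Sset k y ⟨2 * i + 1, by omega⟩, a := by
  have h1 := hya.1 i h
  have h2 : (2 * i + 1) / 2 = 2 * i / 2 := by omega
  rw [sum_Sset hy, sum_Sset hy]
  simp only [h2]
  omega

/-- The sum of all elements of all vertices of the simplex `{S^x_1, S^x_3, …}`. -/
def simplexSum (k : ℕ) (x : Fin (2 * k) → ℕ) : ℕ :=
  ∑ i : Fin k, ∑ a ∈ Sset k x ⟨2 * (i : ℕ), by have := i.isLt; omega⟩, a

lemma Subordinate.sum_le (h : Subordinate k x y) (hy : Function.Injective y) (hya : IsAlt k y)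
    {i : ℕ} (hi : i < k) :
    ∑ a ∈ Sset k y ⟨2 * i, by omega⟩, a ≤ ∑ a ∈ Sset k x ⟨2 * i, by omega⟩, a := by
  rcases h i hi with h' | h' <;> rw [h']
  exact (sum_Sset_even_lt_odd hy hya hi).le

lemma Subordinate.simplexSum_le (h : Subordinate k x y) (hy : Function.Injective y)
    (hya : IsAlt k y) : simplexSum k y ≤ simplexSum k x :=
  Finset.sum_le_sum fun i _ => h.sum_le hy hya i.isLt

lemma Subordinate.Sset_eq (h : Subordinate k x y) (hy : Function.Injective y)
    (hya : IsAlt k y) (hs : simplexSum k x ≤ simplexSum k y) {i : ℕ} (hi : i < k) :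
    Sset k x ⟨2 * i, by omega⟩ = Sset k y ⟨2 * i, by omega⟩ := by
  refine (h i hi).resolve_right fun h' => ?_
  have := (Finset.sum_eq_sum_iff_of_le
    (fun (i : Fin k) _ => h.sum_le hy hya i.isLt)).1
      (le_antisymm (h.simplexSum_le hy hya) hs) ⟨i, hi⟩ (Finset.mem_univ _)
  have h2 := sum_Sset_even_lt_odd hy hya hi
  rw [← h'] at h2
  exact h2.ne this

/-- An alternating permutation is determined by the sets `S^x_1, S^x_3, …`. -/
lemma IsAlt.eq_of_Sset_eq {I : Finset ℕ} (hI : I.card = 2 * k)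
    (hx : Function.Injective x) (hxI : ∀ i, x i ∈ I) (hxa : IsAlt k x)
    (hy : Function.Injective y) (hyI : ∀ i, y i ∈ I) (hya : IsAlt k y)
    (hS : ∀ i, ∀ hi : i < k, Sset k x ⟨2 * i, by omega⟩ = Sset k y ⟨2 * i, by omega⟩) :
    x = y := by
  have key : ∀ i, ∀ hi : i < k, ∀ t : Fin (2 * k), (t : ℕ) ≤ 2 * i → x t = y t := by
    intro i
    induction i with
    | zero =>
      intro hi t ht
      have : x t ∈ Sset k y ⟨2 * 0, by omega⟩ := by
        rw [← hS 0 hi]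
        exact (mem_Sset_even _).2 ⟨t, ht, rfl⟩
      obtain ⟨s, hs, hst⟩ := (mem_Sset_even _).1 this
      rw [← hst]
      congr 1
      exact Fin.ext (by omega)
    | succ i ih =>
      intro hi t ht
      have ih' := ih (by omega)
      have step : ∀ s : Fin (2 * k), 2 * i < (s : ℕ) → (s : ℕ) ≤ 2 * (i + 1) →
          x s = y ⟨2 * i + 1, by omega⟩ ∨ x s = y ⟨2 * i + 2, by omega⟩ := by
        intro s hs1 hs2
        have : x s ∈ Sset k y ⟨2 * (i + 1), by omega⟩ := by
          rw [← hS (i + 1) hi]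
          exact (mem_Sset_even _).2 ⟨s, hs2, rfl⟩
        obtain ⟨r, hr, hrs⟩ := (mem_Sset_even _).1 this
        by_cases hr' : (r : ℕ) ≤ 2 * i
        · rw [← ih' r hr'] at hrs
          have := hx hrs
          subst this
          omega
        · rcases (show (r : ℕ) = 2 * i + 1 ∨ (r : ℕ) = 2 * i + 2 by omega) with h | h
          · left
            rw [← hrs]
            congr 1
            exact Fin.ext h
          · right
            rw [← hrs]
            congr 1
            exact Fin.ext h
      have h1 := step ⟨2 * i + 1, by omega⟩ (by simp) (by simp)
      have h2 := step ⟨2 * i + 2, by omega⟩ (by simp) (by simp; omega)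
      have h3 := hxa.2 i hi
      have h4 := hya.2 i hi
      rcases (show (t : ℕ) ≤ 2 * i ∨ (t : ℕ) = 2 * i + 1 ∨ (t : ℕ) = 2 * i + 2 by omega)
        with h | h | h
      · exact ih' t h
      · rw [show t = ⟨2 * i + 1, by omega⟩ from Fin.ext h]
        omega
      · rw [show t = ⟨2 * i + 2, by omega⟩ from Fin.ext h]
        omega
  funext t
  have hk := t.isLt
  by_cases ht : (t : ℕ) ≤ 2 * (k - 1)
  · exact key (k - 1) (by omega) t ht
  · have himg : Finset.univ.image y = I := by
      apply Finset.eq_of_subset_of_card_le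
      · intro a ha
        obtain ⟨s, -, rfl⟩ := Finset.mem_image.1 ha
        exact hyI s
      · rw [Finset.card_image_of_injective _ hy, hI, Finset.card_univ, Fintype.card_fin]
    obtain ⟨s, -, hs⟩ := Finset.mem_image.1 (himg.symm ▸ hxI t)
    by_cases hs' : (s : ℕ) ≤ 2 * (k - 1)
    · rw [← key (k - 1) (by omega) s hs'] at hs
      have := hx hs
      subst this
      omega
    · rw [← hs]
      congr 1
      exact Fin.ext (by omega)

end AlternatingPotential

section DirectedWalks

variable {k : ℕ} {I : Finset ℕ} {α β : PermOn k I}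

lemma sI_self (α : PermOn k I) : sI k I α α = 1 :=
  if_pos ⟨1, 1, fun _ => rfl, by simp⟩

lemma Walks.isAlt {w : (m : ℕ) × (Fin (m + 1) → PermOn k I)} (hw : w ∈ Walks k I α β)
    (hβ : IsAlt k β.1) (j : Fin (w.1 + 1)) : IsAlt k (w.2 j).1 := by
  obtain ⟨-, -, hlast, hstep, -⟩ := hw
  by_cases h : (j : ℕ) < w.1
  · exact (hstep j h).1
  · obtain rfl : j = Fin.last w.1 := Fin.ext (by simp; omega)
    rwa [hlast]

lemma Walks.antitone {w : (m : ℕ) × (Fin (m + 1) → PermOn k I)} (hw : w ∈ Walks k I α β)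
    (hβ : IsAlt k β.1) : Antitone fun j => simplexSum k (w.2 j).1 :=
  Fin.antitone_iff_succ_le.2 fun j =>
    (hw.2.2.2.1 j j.isLt).2.simplexSum_le (w.2 _).2.1 (Walks.isAlt hw hβ j.succ)

/-- The only closed walk at an alternating permutation is its loop. -/
lemma Walks.self_eq_singleton (hI : I.card = 2 * k) (hα : IsAlt k α.1) :
    Walks k I α α = {⟨1, fun _ => α⟩} := by
  ext w
  simp only [Set.mem_singleton_iff]
  constructor
  · intro hw
    have hanti := Walks.antitone hw hα
    have halt := Walks.isAlt hw hα
    obtain ⟨m, v⟩ := w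
    obtain ⟨hm, h0, hlast, hstep, hne⟩ := hw
    dsimp only at *
    by_cases hm2 : 1 < m
    · have hle : simplexSum k (v 0).1 ≤ simplexSum k (v ⟨1, by omega⟩).1 := by
        have := hanti (Fin.le_last ⟨1, by omega⟩)
        dsimp only at this
        rwa [hlast, ← h0] at this
      refine absurd (Subtype.ext ?_) (hne 0 hm2)
      refine IsAlt.eq_of_Sset_eq hI (v _).2.1 (v _).2.2 (halt _) (v _).2.1 (v _).2.2 (halt _) ?_
      exact fun i hi => (hstep 0 hm).2.Sset_eq (v _).2.1 (halt _) hle hi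
    · obtain rfl : m = 1 := by omega
      congr 1
      funext j
      fin_cases j
      · exact h0
      · exact hlast
  · rintro rfl
    exact ⟨le_rfl, rfl, rfl, fun j _ => ⟨hα, fun i hi => Or.inl rfl⟩, fun j h => by
      dsimp only at h
      omega⟩

/-- Append the vertex `β` to a sequence of permutations. -/
def appendVertex (β : PermOn k I) (w : (m : ℕ) × (Fin (m + 1) → PermOn k I)) :
    (m : ℕ) × (Fin (m + 1) → PermOn k I) :=
  ⟨w.1 + 1, Fin.snoc (α := fun _ => PermOn k I) w.2 β⟩

lemma appendVertex_castSucc (w : (m : ℕ) × (Fin (m + 1) → PermOn k I)) (j : Fin (w.1 + 1)) :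
    (appendVertex β w).2 j.castSucc = w.2 j :=
  Fin.snoc_castSucc (α := fun _ => PermOn k I) _ _ _

lemma appendVertex_last (w : (m : ℕ) × (Fin (m + 1) → PermOn k I)) :
    (appendVertex β w).2 (Fin.last (w.1 + 1)) = β :=
  Fin.snoc_last (α := fun _ => PermOn k I) _ _

lemma appendVertex_injective : Function.Injective (appendVertex β : _ → _) := by
  rintro ⟨m, v⟩ ⟨n, u⟩ h
  obtain rfl : m = n := Nat.succ_injective (congrArg Sigma.fst h)
  congr 1
  have h' := eq_of_heq (Sigma.mk.inj h).2
  funext j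
  have := congrFun h' j.castSucc
  simpa using this

lemma wtW_appendVertex {w : (m : ℕ) × (Fin (m + 1) → PermOn k I)}
    (hw : w.2 (Fin.last w.1) = β) : wtW k I (appendVertex β w) = wtW k I w + 1 := by
  have h : wtW k I (appendVertex β w) =
      ∑ j : Fin (w.1 + 1), sI k I ((appendVertex β w).2 j.castSucc)
        ((appendVertex β w).2 j.succ) := rfl
  rw [h, Fin.sum_univ_castSucc, wtW]
  refine congrArg₂ (· + ·) ?_ ?_
  · refine Finset.sum_congr rfl fun j _ => ?_
    rw [appendVertex_castSucc, Fin.succ_castSucc, appendVertex_castSucc]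
  · rw [appendVertex_castSucc, Fin.succ_last, appendVertex_last, hw, sI_self]

/-- The sequence repeats its last vertex. -/
def EndsInLoop (w : (m : ℕ) × (Fin (m + 1) → PermOn k I)) : Prop :=
  w.2 ⟨w.1 - 1, by omega⟩ = w.2 (Fin.last w.1)

lemma appendVertex_mem {w : (m : ℕ) × (Fin (m + 1) → PermOn k I)} (hβ : IsAlt k β.1)
    (hw : w ∈ Walks k I α β) (hl : ¬ EndsInLoop w) :
    appendVertex β w ∈ Walks k I α β ∧ EndsInLoop (appendVertex β w) := by
  have halt := Walks.isAlt hw hβ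
  obtain ⟨hm, h0, hlast, hstep, hne⟩ := hw
  have hval : ∀ j : ℕ, ∀ h : j < w.1 + 1,
      (appendVertex β w).2 ⟨j, Nat.lt_succ_of_lt h⟩ = w.2 ⟨j, h⟩ :=
    fun j h => appendVertex_castSucc w ⟨j, h⟩
  have hval' : (appendVertex β w).2 ⟨w.1 + 1, Nat.lt_succ_self _⟩ = β := appendVertex_last w
  refine ⟨⟨Nat.succ_pos _, ?_, appendVertex_last w, ?_, ?_⟩, ?_⟩
  · exact (hval 0 (Nat.succ_pos _)).trans h0
  · intro j h
    have h : j < w.1 + 1 := h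
    rw [hval j h]
    refine ⟨halt _, ?_⟩
    by_cases hj : j < w.1
    · rw [hval (j + 1) (by omega)]
      exact (hstep j hj).2
    · obtain rfl : j = w.1 := by omega
      rw [hval', show w.2 ⟨w.1, h⟩ = β from hlast]
      exact fun i hi => Or.inl rfl
  · intro j h
    have h : j + 1 < w.1 + 1 := h
    rw [hval j (by omega), hval (j + 1) h]
    by_cases hj : j + 1 < w.1
    · exact hne j hj
    · obtain rfl : j = w.1 - 1 := by omega
      intro he
      refine hl (he.trans ?_)
      exact congrArg w.2 (Fin.ext (Nat.sub_add_cancel hm))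
  · exact ((hval w.1 (Nat.lt_succ_self _)).trans hlast).trans hval'.symm

lemma exists_appendVertex {w : (m : ℕ) × (Fin (m + 1) → PermOn k I)} (hαβ : α ≠ β)
    (hw : w ∈ Walks k I α β) (hl : EndsInLoop w) :
    ∃ u ∈ Walks k I α β, ¬ EndsInLoop u ∧ appendVertex β u = w := by
  obtain ⟨m, v⟩ := w
  obtain ⟨hm, h0, hlast, hstep, hne⟩ := hw
  obtain ⟨n, rfl⟩ : ∃ n, m = n + 1 := ⟨m - 1, by dsimp only at hm; omega⟩
  have hloop : v ⟨n, by omega⟩ = β := Eq.trans hl hlast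
  dsimp only at *
  have hn : 1 ≤ n := by
    by_contra h
    obtain rfl : n = 0 := by omega
    exact hαβ (h0.symm.trans hloop)
  refine ⟨⟨n, fun j => v j.castSucc⟩, ⟨hn, h0, hloop, ?_, ?_⟩, ?_, ?_⟩
  · exact fun j h => hstep j (Nat.lt_succ_of_lt h)
  · exact fun j h => hne j (Nat.lt_succ_of_lt h)
  · intro he
    refine hne (n - 1) (by omega) (Eq.trans he ?_)
    exact congrArg v (Fin.ext (Nat.sub_add_cancel hn).symm)
  · refine Sigma.ext rfl (heq_of_eq ?_)
    funext j
    refine Fin.lastCases ?_ (fun j => ?_) j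
    · exact (appendVertex_last _).trans hlast.symm
    · exact appendVertex_castSucc ⟨n, fun j => v j.castSucc⟩ j

/-- Appending a loop at the end is a sign-reversing matching of the walks. -/
lemma finsum_Walks_eq_zero (hβ : IsAlt k β.1) (hαβ : α ≠ β) :
    ∑ᶠ p ∈ Walks k I α β, (-1 : ℚ) ^ (wtW k I p) = 0 := by
  by_cases hfin : (Walks k I α β).Finite
  · have hsplit := finsum_mem_inter_add_sdiff {w | EndsInLoop w}
      (f := fun p => (-1 : ℚ) ^ (wtW k I p)) hfin
    have hbij : Set.BijOn (appendVertex β) (Walks k I α β \ {w | EndsInLoop w})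
        (Walks k I α β ∩ {w | EndsInLoop w}) := by
      refine ⟨fun w hw => appendVertex_mem hβ hw.1 hw.2, appendVertex_injective.injOn, ?_⟩
      rintro w ⟨hw, hl⟩
      obtain ⟨u, hu, hul, rfl⟩ := exists_appendVertex hαβ hw hl
      exact ⟨u, ⟨hu, hul⟩, rfl⟩
    have hneg := finsum_mem_eq_of_bijOn (f := fun p => -(-1 : ℚ) ^ (wtW k I p))
      (g := fun p => (-1 : ℚ) ^ (wtW k I p)) _ hbij fun w hw => by
        rw [wtW_appendVertex hw.1.2.2.1, pow_succ]
        ring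
    rw [finsum_mem_neg_distrib _ (hfin.subset Set.sdiff_subset)] at hneg
    rw [← hsplit, ← hneg]
    ring
  · refine finsum_mem_eq_zero_of_infinite ?_
    rwa [Set.inter_eq_left.2 fun p _ => ?_]
    simp

end DirectedWalks

/-- For `α, β ∈ Alt_I`, `TC^α_β = 1` if `α = β` and `0` otherwise. -/
theorem statement9 (k : ℕ) (hk : 1 ≤ k) (I : Finset ℕ) (hI : I.card = 2 * k)
    (α β : PermOn k I) (hα : IsAlt k α.1) (hβ : IsAlt k β.1) :
    TCoef k I α β = if α = β then 1 else 0 := by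
  rw [TCoef]
  split_ifs with h
  · subst h
    rw [Walks.self_eq_singleton hI hα, finsum_mem_singleton]
    simp [wtW, sI_self]
  · rw [finsum_Walks_eq_zero hβ h, neg_zero]
end
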